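/- arXiv:2303.01240 — 6 statements merged into one kernel-verified Lean document; each statement's English description precedes it below -/
import Mathlib

section
/- Let A be a finite nonempty type, q : A → ℝ, and η > 0. If π is a probability distribution on A with ∑_a π(a)·q(a) + η·H(π) = η · log (∑_a exp(q(a)/η)), then π(a) = exp(q(a)/η) / ∑_b exp(q(b)/η) for every a, i.e., the softmax distribution is the unique maximizer of the entropy-regularized objective. -/
open Finset

theorem mul_log_sub_log_le_sub {x y : ℝ} (hx : 0 ≤ x) (hy : 0 < y) :
    x * (Real.log y - Real.log x) ≤ y - x := by
  rcases hx.eq_or_lt with rfl | hx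
  · simpa using hy.le
  · rw [← Real.log_div hy.ne' hx.ne']
    calc x * Real.log (y / x) ≤ x * (y / x - 1) :=
          mul_le_mul_of_nonneg_left (Real.log_le_sub_one_of_pos (div_pos hy hx)) hx.le
      _ = y - x := by field_simp

theorem eq_of_mul_log_sub_log_eq_sub {x y : ℝ} (hx : 0 ≤ x) (hy : 0 < y)
    (h : x * (Real.log y - Real.log x) = y - x) : x = y := by
  rcases hx.eq_or_lt with rfl | hx
  · simp only [zero_mul] at h
    linarith
  · by_contra hne
    have hyx : y / x ≠ 1 := fun h1 => hne ((div_eq_one_iff_eq hx.ne').1 h1).symm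
    have hlt := mul_lt_mul_of_pos_left (Real.log_lt_sub_one_of_pos (div_pos hy hx) hyx) hx
    have heq : x * (y / x - 1) = y - x := by field_simp
    rw [Real.log_div hy.ne' hx.ne', heq] at hlt
    exact hlt.ne h

/-- The equality case of Gibbs' inequality. -/
theorem eq_of_sum_mul_log_sub_log_eq_zero {A : Type*} [Fintype A] {p s : A → ℝ}
    (hp : ∀ a, 0 ≤ p a) (hs : ∀ a, 0 < s a) (hsum : ∑ a, p a = ∑ a, s a)
    (h : ∑ a, p a * (Real.log (s a) - Real.log (p a)) = 0) (a : A) : p a = s a := by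
  have hsub : ∑ a, p a * (Real.log (s a) - Real.log (p a)) = ∑ a, (s a - p a) := by
    rw [h, sum_sub_distrib, hsum, sub_self]
  exact eq_of_mul_log_sub_log_eq_sub (hp a) (hs a)
    ((sum_eq_sum_iff_of_le fun a _ => mul_log_sub_log_le_sub (hp a) (hs a)).1 hsub a (mem_univ a))

/-- The softmax distribution is the unique maximizer of the entropy-regularized
objective: any probability distribution attaining the log-sum-exp value is the softmax. -/
theorem stmt_3 (A : Type*) [Fintype A] [Nonempty A] (q : A → ℝ) (η : ℝ) (hη : 0 < η)
    (p : A → ℝ) (hp0 : ∀ a, 0 ≤ p a) (hp1 : (∑ a, p a) = 1)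
    (heq : (∑ a, p a * q a) + η * (-∑ a, p a * Real.log (p a)) =
      η * Real.log (∑ a, Real.exp (q a / η))) :
    ∀ a, p a = Real.exp (q a / η) / ∑ b, Real.exp (q b / η) := by
  have hZ : 0 < ∑ b, Real.exp (q b / η) :=
    sum_pos (fun b _ => Real.exp_pos _) univ_nonempty
  refine eq_of_sum_mul_log_sub_log_eq_zero hp0 (fun a => div_pos (Real.exp_pos _) hZ) ?_ ?_
  · rw [hp1, ← sum_div, div_self hZ.ne']
  · simp only [Real.log_div (Real.exp_ne_zero _) hZ.ne', Real.log_exp, mul_sub, sum_sub_distrib,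
      ← sum_mul, hp1, one_mul, ← mul_div_assoc, ← sum_div]
    field_simp
    linarith
end

section
/- Let A be a finite nonempty type, q : A → ℝ, η > 0, and let π̄ be a probability distribution on A with π̄(a) > 0 for all a. Then the supremum, over all probability distributions π on A, of ∑_a π(a)·q(a) − η·D_KL(π‖π̄) (where D_KL(π‖π̄) = ∑_a π(a)·log(π(a)/π̄(a))) equals η · log (∑_a π̄(a)·exp(q(a)/η)). -/
open Finset

/-- Pointwise Gibbs inequality: the term-by-term form of the Donsker–Varadhan upper bound. -/
theorem mul_sub_mul_log_div_le {p q η b Z : ℝ} (hη : 0 < η) (hb : 0 < b) (hZ : 0 < Z)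
    (hp : 0 ≤ p) :
    p * q - η * (p * Real.log (p / b)) ≤
      p * (η * Real.log Z) + η * (b * Real.exp (q / η) / Z - p) := by
  rcases hp.eq_or_lt with rfl | hp
  · simp only [zero_mul, mul_zero, sub_zero, zero_add]
    positivity
  · have hlog := Real.log_le_sub_one_of_pos
      (show 0 < b * Real.exp (q / η) / (p * Z) by positivity)
    rw [Real.log_div (by positivity) (by positivity), Real.log_mul hb.ne' (Real.exp_ne_zero _),
      Real.log_exp, Real.log_mul hp.ne' hZ.ne'] at hlog
    rw [Real.log_div hp.ne' hb.ne']
    have hmul := mul_le_mul_of_nonneg_left hlog (mul_pos hη hp).le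
    have hleft : η * p * (Real.log b + q / η - (Real.log p + Real.log Z)) =
        p * q - η * (p * (Real.log p - Real.log b)) - p * (η * Real.log Z) := by
      field_simp
      ring
    have hright : η * p * (b * Real.exp (q / η) / (p * Z) - 1) =
        η * (b * Real.exp (q / η) / Z - p) := by
      field_simp
    linarith

/-- KL-regularized linear objective over the probability simplex: its supremum
equals `η · log (∑ a, π̄ a · exp (q a / η))`. -/
theorem stmt_4 (A : Type*) [Fintype A] [Nonempty A] (q : A → ℝ) (η : ℝ) (hη : 0 < η)
    (pbar : A → ℝ) (hpbar0 : ∀ a, 0 < pbar a) (hpbar1 : (∑ a, pbar a) = 1) :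
    sSup {x : ℝ | ∃ p : A → ℝ, (∀ a, 0 ≤ p a) ∧ (∑ a, p a) = 1 ∧
        x = (∑ a, p a * q a) - η * (∑ a, p a * Real.log (p a / pbar a))} =
      η * Real.log (∑ a, pbar a * Real.exp (q a / η)) := by
  set Z := ∑ a, pbar a * Real.exp (q a / η) with hZdef
  have hZ : 0 < Z :=
    Finset.sum_pos (fun a _ => mul_pos (hpbar0 a) (Real.exp_pos _)) Finset.univ_nonempty
  have hgibbs : ∑ a, pbar a * Real.exp (q a / η) / Z = 1 := by
    rw [← Finset.sum_div, ← hZdef, div_self hZ.ne']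
  refine IsGreatest.csSup_eq ⟨?_, ?_⟩
  · refine ⟨fun a => pbar a * Real.exp (q a / η) / Z, fun a => ?_, hgibbs, ?_⟩
    · have := hpbar0 a
      positivity
    · rw [Finset.mul_sum, ← Finset.sum_sub_distrib]
      have hterm : ∀ a, pbar a * Real.exp (q a / η) / Z * q a -
          η * (pbar a * Real.exp (q a / η) / Z *
            Real.log (pbar a * Real.exp (q a / η) / Z / pbar a)) =
          pbar a * Real.exp (q a / η) / Z * (η * Real.log Z) := by
        intro a
        have hratio : pbar a * Real.exp (q a / η) / Z / pbar a = Real.exp (q a / η) / Z := by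
          have := (hpbar0 a).ne'
          field_simp
        rw [hratio, Real.log_div (Real.exp_ne_zero _) hZ.ne', Real.log_exp]
        field_simp
        ring
      rw [Finset.sum_congr rfl fun a _ => hterm a, ← Finset.sum_mul, hgibbs, one_mul]
  · rintro x ⟨p, hp0, hp1, rfl⟩
    rw [Finset.mul_sum, ← Finset.sum_sub_distrib]
    refine (Finset.sum_le_sum fun a _ =>
      mul_sub_mul_log_div_le hη (hpbar0 a) hZ (hp0 a)).trans_eq ?_
    rw [Finset.sum_add_distrib, ← Finset.sum_mul, ← Finset.mul_sum, Finset.sum_sub_distrib,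
      hp1, hgibbs]
    ring
end

section
/- Let S and A be finite nonempty types, r : S → A → ℝ, γ ∈ [0,1), η > 0, let p : S → A → S → ℝ satisfy p(s,a,s') ≥ 0 and ∑_{s'} p(s,a,s') = 1, and let π be a policy. Then the soft Bellman operator T^π, defined by (T^π Q)(s,a) = r(s,a) + γ · ∑_{s'} p(s,a,s') · (∑_b π(s',b)·(Q(s',b) − η·log π(s',b))), has a unique fixed point Q^π : S → A → ℝ (soft policy evaluation converges). -/
open Finset

/-- A weighted average of reals of absolute value at most `C` has absolute value at most `C`. -/
theorem abs_sum_mul_le_of_sum_eq_one {ι : Type*} [Fintype ι] {w f : ι → ℝ} {C : ℝ}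
    (hw : ∀ i, 0 ≤ w i) (hw1 : ∑ i, w i = 1) (hf : ∀ i, |f i| ≤ C) :
    |∑ i, w i * f i| ≤ C :=
  calc |∑ i, w i * f i| ≤ ∑ i, |w i * f i| := abs_sum_le_sum_abs _ _
    _ ≤ ∑ i, w i * C := sum_le_sum fun i _ => by
      rw [abs_mul, abs_of_nonneg (hw i)]
      exact mul_le_mul_of_nonneg_left (hf i) (hw i)
    _ = C := by rw [← sum_mul, hw1, one_mul]

/-- The soft Bellman operator `T^π` has a unique fixed point
(soft policy evaluation converges). -/
theorem stmt_10 (S A : Type*) [Fintype S] [Nonempty S] [Fintype A] [Nonempty A]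
    (r : S → A → ℝ) (γ : ℝ) (hγ0 : 0 ≤ γ) (hγ1 : γ < 1) (η : ℝ) (hη : 0 < η)
    (p : S → A → S → ℝ) (hp0 : ∀ s a s', 0 ≤ p s a s') (hp1 : ∀ s a, (∑ s', p s a s') = 1)
    (pol : S → A → ℝ) (hpol0 : ∀ s a, 0 ≤ pol s a) (hpol1 : ∀ s, (∑ a, pol s a) = 1)
    (T : (S → A → ℝ) → S → A → ℝ)
    (hT : ∀ Q s a, T Q s a = r s a + γ * ∑ s', p s a s' *
        (∑ b, pol s' b * (Q s' b - η * Real.log (pol s' b)))) :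
    ∃! Q : S → A → ℝ, T Q = Q := by
  have hT_contracting : ContractingWith ⟨γ, hγ0⟩ T := by
    refine ⟨NNReal.coe_lt_coe.1 hγ1, LipschitzWith.of_dist_le_mul fun Q R => ?_⟩
    have hC : 0 ≤ γ * dist Q R := mul_nonneg hγ0 dist_nonneg
    refine (dist_pi_le_iff hC).2 fun s => (dist_pi_le_iff hC).2 fun a => ?_
    have hdiff : T Q s a - T R s a =
        γ * ∑ s', p s a s' * ∑ b, pol s' b * (Q s' b - R s' b) := by
      rw [hT, hT, add_sub_add_left_eq_sub, ← mul_sub, ← sum_sub_distrib]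
      simp only [← mul_sub, ← sum_sub_distrib, sub_sub_sub_cancel_right]
    rw [Real.dist_eq, hdiff, abs_mul, abs_of_nonneg hγ0]
    refine mul_le_mul_of_nonneg_left ?_ hγ0
    refine abs_sum_mul_le_of_sum_eq_one (hp0 s a) (hp1 s a) fun s' =>
      abs_sum_mul_le_of_sum_eq_one (hpol0 s') (hpol1 s') fun b => ?_
    rw [← Real.dist_eq]
    exact (dist_le_pi_dist (Q s') (R s') b).trans (dist_le_pi_dist Q R s')
  exact ⟨hT_contracting.fixedPoint T, hT_contracting.fixedPoint_isFixedPt,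
    fun Q hQ => hT_contracting.fixedPoint_unique hQ⟩
end

section
/- Let S and A be finite nonempty types, r : S → A → ℝ, γ ∈ [0,1), η > 0, and let p : S → A → S → ℝ satisfy p(s,a,s') ≥ 0 and ∑_{s'} p(s,a,s') = 1. Define the soft optimality Bellman operator T* on functions Q : S → A → ℝ by (T* Q)(s,a) = r(s,a) + γ · ∑_{s'} p(s,a,s') · η·log(∑_b exp(Q(s',b)/η)). Then for all Q₁, Q₂ : S → A → ℝ, sup_{(s,a)} |(T* Q₁)(s,a) − (T* Q₂)(s,a)| ≤ γ · sup_{(s,a)} |Q₁(s,a) − Q₂(s,a)|, i.e., T* is a γ-contraction in the sup norm. -/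
open Finset

/-- A uniform upper bound on the difference of two functions bounds the difference of their
scaled log-sum-exp values. -/
theorem mul_log_sum_exp_div_le_add {A : Type*} [Fintype A] [Nonempty A] {η : ℝ} (hη : 0 < η)
    {f g : A → ℝ} {M : ℝ} (h : ∀ b, f b ≤ g b + M) :
    η * Real.log (∑ b, Real.exp (f b / η)) ≤ η * Real.log (∑ b, Real.exp (g b / η)) + M := by
  have hpos : ∀ k : A → ℝ, 0 < ∑ b, Real.exp (k b / η) := fun k =>
    Finset.sum_pos (fun b _ => Real.exp_pos _) Finset.univ_nonempty
  have hle : ∑ b, Real.exp (f b / η) ≤ (∑ b, Real.exp (g b / η)) * Real.exp (M / η) := by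
    rw [Finset.sum_mul]
    refine Finset.sum_le_sum fun b _ => ?_
    rw [← Real.exp_add, ← add_div]
    exact Real.exp_le_exp.2 (div_le_div_of_nonneg_right (h b) hη.le)
  have hlog := Real.log_le_log (hpos f) hle
  rw [Real.log_mul (hpos g).ne' (Real.exp_pos _).ne', Real.log_exp] at hlog
  calc η * Real.log (∑ b, Real.exp (f b / η))
      ≤ η * (Real.log (∑ b, Real.exp (g b / η)) + M / η) :=
        mul_le_mul_of_nonneg_left hlog hη.le
    _ = η * Real.log (∑ b, Real.exp (g b / η)) + M := by field_simp

/-- The scaled log-sum-exp function is nonexpansive in the sup norm. -/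
theorem abs_mul_log_sum_exp_div_sub_le {A : Type*} [Fintype A] [Nonempty A] {η : ℝ} (hη : 0 < η)
    {f g : A → ℝ} {M : ℝ} (h : ∀ b, |f b - g b| ≤ M) :
    |η * Real.log (∑ b, Real.exp (f b / η)) - η * Real.log (∑ b, Real.exp (g b / η))| ≤ M := by
  have h₁ := mul_log_sum_exp_div_le_add hη (f := f) (g := g) (M := M)
    fun b => by linarith [(abs_le.1 (h b)).2]
  have h₂ := mul_log_sum_exp_div_le_add hη (f := g) (g := f) (M := M)
    fun b => by linarith [(abs_le.1 (h b)).1]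
  exact abs_le.2 ⟨by linarith, by linarith⟩

/-- The soft optimality Bellman operator `T*` is a `γ`-contraction in the sup norm. -/
theorem stmt_11 (S A : Type*) [Fintype S] [Nonempty S] [Fintype A] [Nonempty A]
    (r : S → A → ℝ) (γ : ℝ) (hγ0 : 0 ≤ γ) (hγ1 : γ < 1) (η : ℝ) (hη : 0 < η)
    (p : S → A → S → ℝ) (hp0 : ∀ s a s', 0 ≤ p s a s') (hp1 : ∀ s a, (∑ s', p s a s') = 1)
    (T : (S → A → ℝ) → S → A → ℝ)
    (hT : ∀ Q s a, T Q s a = r s a + γ * ∑ s', p s a s' *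
        (η * Real.log (∑ b, Real.exp (Q s' b / η)))) :
    ∀ Q₁ Q₂ : S → A → ℝ,
      (⨆ sa : S × A, |T Q₁ sa.1 sa.2 - T Q₂ sa.1 sa.2|) ≤
        γ * ⨆ sa : S × A, |Q₁ sa.1 sa.2 - Q₂ sa.1 sa.2| := by
  intro Q₁ Q₂
  refine ciSup_le fun ⟨s, a⟩ => ?_
  set M := ⨆ sa : S × A, |Q₁ sa.1 sa.2 - Q₂ sa.1 sa.2|
  have hM : ∀ s b, |Q₁ s b - Q₂ s b| ≤ M := fun s b =>
    le_ciSup (f := fun sa : S × A => |Q₁ sa.1 sa.2 - Q₂ sa.1 sa.2|)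
      (Set.finite_range _).bddAbove (s, b)
  simp only [hT]
  rw [add_sub_add_left_eq_sub, ← mul_sub, ← Finset.sum_sub_distrib, abs_mul, abs_of_nonneg hγ0]
  refine mul_le_mul_of_nonneg_left ?_ hγ0
  calc _ ≤ ∑ s', p s a s' * M := by
        refine (Finset.abs_sum_le_sum_abs _ _).trans (Finset.sum_le_sum fun s' _ => ?_)
        rw [← mul_sub, abs_mul, abs_of_nonneg (hp0 s a s')]
        exact mul_le_mul_of_nonneg_left (abs_mul_log_sum_exp_div_sub_le hη (hM s')) (hp0 s a s')
    _ = M := by rw [← Finset.sum_mul, hp1, one_mul]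
end

section
/- Let S and A be finite nonempty types, r : S → A → ℝ, γ ∈ [0,1), η > 0, and let p : S → A → S → ℝ satisfy p(s,a,s') ≥ 0 and ∑_{s'} p(s,a,s') = 1. Suppose V* : S → ℝ satisfies the optimal soft Bellman equation V*(s) = η·log(∑_a exp((r(s,a) + γ·∑_{s'} p(s,a,s')·V*(s'))/η)) for all s, and define Q̃*(s,a) = r(s,a) + γ·∑_{s'} p(s,a,s')·V*(s'). Suppose Q : S → A → ℝ is a fixed point of the soft Bellman operator T^π for the policy π(s,a) = exp(Q(s,a)/η)/∑_b exp(Q(s,b)/η), where (T^π Q)(s,a) = r(s,a) + γ·∑_{s'} p(s,a,s')·(∑_b π(s',b)·(Q(s',b) − η·log π(s',b))). Then Q(s,a) = Q̃*(s,a) for all (s,a), and π(s,a) = exp(Q̃*(s,a)/η)/∑_b exp(Q̃*(s,b)/η) for all (s,a). -/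
open Finset

/-- The log-sum-exp function with temperature `η`. -/
noncomputable def softMax {A : Type*} [Fintype A] (η : ℝ) (x : A → ℝ) : ℝ :=
  η * Real.log (∑ a, Real.exp (x a / η))

theorem sum_exp_div_pos {A : Type*} [Fintype A] [Nonempty A] (η : ℝ) (x : A → ℝ) :
    0 < ∑ a, Real.exp (x a / η) :=
  Finset.sum_pos (fun _ _ => Real.exp_pos _) Finset.univ_nonempty

theorem softMax_le_add {A : Type*} [Fintype A] [Nonempty A] {η : ℝ} (hη : 0 < η)
    {x y : A → ℝ} {c : ℝ} (h : ∀ a, x a ≤ y a + c) :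
    softMax η x ≤ softMax η y + c := by
  have hsum : ∑ a, Real.exp (x a / η) ≤ (∑ a, Real.exp (y a / η)) * Real.exp (c / η) := by
    rw [Finset.sum_mul]
    refine Finset.sum_le_sum fun a _ => ?_
    rw [← Real.exp_add, ← add_div]
    gcongr
    exact h a
  have hlog := Real.log_le_log (sum_exp_div_pos η x) hsum
  rw [Real.log_mul (sum_exp_div_pos η y).ne' (Real.exp_pos _).ne', Real.log_exp] at hlog
  calc softMax η x ≤ η * (Real.log (∑ a, Real.exp (y a / η)) + c / η) :=
        mul_le_mul_of_nonneg_left hlog hη.le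
    _ = softMax η y + c := by
        unfold softMax
        field_simp

/-- The entropy-regularized value of the softmax policy is the log-sum-exp of the action values. -/
theorem sum_softmax_mul_sub_log {A : Type*} [Fintype A] [Nonempty A] {η : ℝ} (hη : 0 < η)
    {x w : A → ℝ} (hw : ∀ a, w a = Real.exp (x a / η) / ∑ b, Real.exp (x b / η)) :
    ∑ b, w b * (x b - η * Real.log (w b)) = softMax η x := by
  have hZ := (sum_exp_div_pos η x).ne'
  have hterm (b : A) : x b - η * Real.log (w b) = softMax η x := by
    rw [hw, Real.log_div (Real.exp_pos _).ne' hZ, Real.log_exp]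
    unfold softMax
    field_simp
    ring
  have hone : ∑ b, w b = 1 := by
    simp_rw [hw]
    rw [← Finset.sum_div, div_self hZ]
  simp_rw [hterm]
  rw [← Finset.sum_mul, hone, one_mul]

/-- Comparison of two solutions of the optimal soft Bellman equation. -/
theorem softBellman_solution_le {S A : Type*} [Fintype S] [Nonempty S] [Fintype A] [Nonempty A]
    {r : S → A → ℝ} {γ : ℝ} (hγ0 : 0 ≤ γ) (hγ1 : γ < 1) {η : ℝ} (hη : 0 < η)
    {p : S → A → S → ℝ} (hp0 : ∀ s a s', 0 ≤ p s a s') (hp1 : ∀ s a, (∑ s', p s a s') = 1)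
    {U W : S → ℝ}
    (hU : ∀ s, U s = softMax η fun a => r s a + γ * ∑ s', p s a s' * U s')
    (hW : ∀ s, W s = softMax η fun a => r s a + γ * ∑ s', p s a s' * W s') (s : S) :
    U s ≤ W s := by
  obtain ⟨t, ht⟩ := Finite.exists_max fun s => U s - W s
  have hstep (a : A) : r t a + γ * ∑ s', p t a s' * U s' ≤
      (r t a + γ * ∑ s', p t a s' * W s') + γ * (U t - W t) := by
    have hexp : ∑ s', p t a s' * U s' ≤ ∑ s', p t a s' * W s' + (U t - W t) := by
      calc ∑ s', p t a s' * U s' ≤ ∑ s', (p t a s' * W s' + p t a s' * (U t - W t)) := by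
            refine Finset.sum_le_sum fun s' _ => ?_
            rw [← mul_add]
            exact mul_le_mul_of_nonneg_left (by linarith [ht s']) (hp0 t a s')
        _ = ∑ s', p t a s' * W s' + (U t - W t) := by
            rw [Finset.sum_add_distrib, ← Finset.sum_mul, hp1, one_mul]
    linarith [mul_le_mul_of_nonneg_left hexp hγ0]
  have hle := softMax_le_add hη hstep
  rw [← hU t, ← hW t] at hle
  have hD : U t - W t ≤ 0 := by nlinarith
  linarith [ht s]

/-- If `V*` satisfies the optimal soft Bellman equation, `Q̃*` is its induced
action-value function, and `Q` is a fixed point of the soft Bellman operator for its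
own softmax policy `π`, then `Q = Q̃*` and `π` is the softmax of `Q̃*`. -/
theorem stmt_13 (S A : Type*) [Fintype S] [Nonempty S] [Fintype A] [Nonempty A]
    (r : S → A → ℝ) (γ : ℝ) (hγ0 : 0 ≤ γ) (hγ1 : γ < 1) (η : ℝ) (hη : 0 < η)
    (p : S → A → S → ℝ) (hp0 : ∀ s a s', 0 ≤ p s a s') (hp1 : ∀ s a, (∑ s', p s a s') = 1)
    (Vstar : S → ℝ)
    (hVstar : ∀ s, Vstar s = η * Real.log (∑ a, Real.exp
        ((r s a + γ * ∑ s', p s a s' * Vstar s') / η)))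
    (Qstar : S → A → ℝ)
    (hQstar : ∀ s a, Qstar s a = r s a + γ * ∑ s', p s a s' * Vstar s')
    (Q : S → A → ℝ) (pol : S → A → ℝ)
    (hpol : ∀ s a, pol s a = Real.exp (Q s a / η) / ∑ b, Real.exp (Q s b / η))
    (hfix : ∀ s a, Q s a = r s a + γ * ∑ s', p s a s' *
        (∑ b, pol s' b * (Q s' b - η * Real.log (pol s' b)))) :
    (∀ s a, Q s a = Qstar s a) ∧
      (∀ s a, pol s a = Real.exp (Qstar s a / η) / ∑ b, Real.exp (Qstar s b / η)) := by
  have hQ (s : S) (a : A) : Q s a = r s a + γ * ∑ s', p s a s' * softMax η (Q s') := by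
    simpa only [sum_softmax_mul_sub_log hη (hpol _)] using hfix s a
  have hV (s : S) : softMax η (Q s) =
      softMax η fun a => r s a + γ * ∑ s', p s a s' * softMax η (Q s') :=
    congrArg (softMax η) (funext (hQ s))
  have hVeq (s : S) : softMax η (Q s) = Vstar s :=
    le_antisymm (softBellman_solution_le hγ0 hγ1 hη hp0 hp1 hV hVstar s)
      (softBellman_solution_le hγ0 hγ1 hη hp0 hp1 hVstar hV s)
  have hQeq (s : S) (a : A) : Q s a = Qstar s a := by
    rw [hQ, hQstar]
    simp_rw [hVeq]
  exact ⟨hQeq, fun s a => by simp_rw [hpol, hQeq]⟩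
end

section
/- Let S and A be finite nonempty types, r : S → A → ℝ, γ ∈ [0,1), η > 0, and let p : S → A → S → ℝ satisfy p(s,a,s') ≥ 0 and ∑_{s'} p(s,a,s') = 1. Let π be a policy and Q : S → A → ℝ the fixed point of the soft Bellman operator T^π. Define the improved policy π'(s,a) = exp(Q(s,a)/η)/∑_b exp(Q(s,b)/η), and let Q' : S → A → ℝ be the fixed point of T^{π'}. Then Q'(s,a) ≥ Q(s,a) for all (s,a) (soft policy improvement). -/
open Finset

theorem mul_sub_mul_log_le {η x w : ℝ} (hη : 0 ≤ η) (hx : 0 ≤ x) (hw : 0 < w) :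
    x * (η * Real.log w - η * Real.log x) ≤ η * (w - x) := by
  rcases hx.eq_or_lt with rfl | hx
  · simpa using mul_nonneg hη hw.le
  have h := Real.log_le_sub_one_of_pos (div_pos hw hx)
  rw [Real.log_div hw.ne' hx.ne'] at h
  have h' := mul_le_mul_of_nonneg_left h (mul_nonneg hη hx.le)
  have hxw : η * x * (w / x - 1) = η * (w - x) := by field_simp
  linarith

/-- Gibbs variational principle: the softmax distribution of `q` maximises the
entropy-regularised expectation of `q`. -/
theorem sum_mul_sub_log_le_softmax {A : Type*} [Fintype A] [Nonempty A] {η : ℝ} (hη : 0 < η)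
    {q x w : A → ℝ} (hx0 : ∀ a, 0 ≤ x a) (hx1 : ∑ a, x a = 1)
    (hw : ∀ a, w a = Real.exp (q a / η) / ∑ b, Real.exp (q b / η)) :
    ∑ a, x a * (q a - η * Real.log (x a)) ≤ ∑ a, w a * (q a - η * Real.log (w a)) := by
  set Z := ∑ b, Real.exp (q b / η)
  have hZ : 0 < Z := sum_pos (fun b _ => Real.exp_pos _) univ_nonempty
  have hwpos (a : A) : 0 < w a := hw a ▸ div_pos (Real.exp_pos _) hZ
  have hw1 : ∑ a, w a = 1 := by
    simp_rw [hw, ← sum_div]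
    exact div_self hZ.ne'
  have hlog (a : A) : q a - η * Real.log (w a) = η * Real.log Z := by
    rw [hw, Real.log_div (Real.exp_ne_zero _) hZ.ne', Real.log_exp]
    field_simp
    ring
  calc ∑ a, x a * (q a - η * Real.log (x a))
      ≤ ∑ a, (x a * (η * Real.log Z) + η * (w a - x a)) := by
        refine sum_le_sum fun a _ => ?_
        have h := mul_sub_mul_log_le hη.le (hx0 a) (hwpos a)
        rw [← hlog a]
        linarith
    _ = η * Real.log Z := by
        rw [sum_add_distrib, ← sum_mul, ← mul_sum, sum_sub_distrib, hx1, hw1]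
        ring
    _ = ∑ a, w a * (q a - η * Real.log (w a)) := by
        simp_rw [hlog, ← sum_mul, hw1, one_mul]

/-- Soft policy improvement: if `Q` is the fixed point of the soft Bellman operator for a
policy `π`, `π'` is the softmax policy of `Q`, and `Q'` is the fixed point of the soft
Bellman operator for `π'`, then `Q' ≥ Q` pointwise. -/
theorem stmt_14 (S A : Type*) [Fintype S] [Nonempty S] [Fintype A] [Nonempty A]
    (r : S → A → ℝ) (γ : ℝ) (hγ0 : 0 ≤ γ) (hγ1 : γ < 1) (η : ℝ) (hη : 0 < η)
    (p : S → A → S → ℝ) (hp0 : ∀ s a s', 0 ≤ p s a s') (hp1 : ∀ s a, (∑ s', p s a s') = 1)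
    (pol : S → A → ℝ) (hpol0 : ∀ s a, 0 ≤ pol s a) (hpol1 : ∀ s, (∑ a, pol s a) = 1)
    (Q : S → A → ℝ)
    (hQfix : ∀ s a, Q s a = r s a + γ * ∑ s', p s a s' *
        (∑ b, pol s' b * (Q s' b - η * Real.log (pol s' b))))
    (pol' : S → A → ℝ)
    (hpol' : ∀ s a, pol' s a = Real.exp (Q s a / η) / ∑ b, Real.exp (Q s b / η))
    (Q' : S → A → ℝ)
    (hQ'fix : ∀ s a, Q' s a = r s a + γ * ∑ s', p s a s' *
        (∑ b, pol' s' b * (Q' s' b - η * Real.log (pol' s' b)))) :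
    ∀ s a, Q s a ≤ Q' s a := by
  have hZ (s : S) : 0 < ∑ b, Real.exp (Q s b / η) :=
    sum_pos (fun b _ => Real.exp_pos _) univ_nonempty
  have hpol'0 (s : S) (a : A) : 0 ≤ pol' s a :=
    hpol' s a ▸ div_nonneg (Real.exp_pos _).le (hZ s).le
  have hpol'1 (s : S) : ∑ a, pol' s a = 1 := by
    simp_rw [hpol', ← sum_div]
    exact div_self (hZ s).ne'
  obtain ⟨⟨s₀, a₀⟩, hmax⟩ := Finite.exists_max fun x : S × A => Q x.1 x.2 - Q' x.1 x.2
  set d := Q s₀ a₀ - Q' s₀ a₀ with hd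
  have hle (s : S) (a : A) : Q s a - Q' s a ≤ d := hmax (s, a)
  have hV (s : S) : ∑ b, pol s b * (Q s b - η * Real.log (pol s b)) ≤
      (∑ b, pol' s b * (Q' s b - η * Real.log (pol' s b))) + d :=
    calc ∑ b, pol s b * (Q s b - η * Real.log (pol s b))
        ≤ ∑ b, pol' s b * (Q s b - η * Real.log (pol' s b)) :=
          sum_mul_sub_log_le_softmax hη (hpol0 s) (hpol1 s) (hpol' s)
      _ ≤ ∑ b, (pol' s b * (Q' s b - η * Real.log (pol' s b)) + pol' s b * d) := by
          refine sum_le_sum fun b _ => ?_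
          rw [← mul_add]
          exact mul_le_mul_of_nonneg_left (by linarith [hle s b]) (hpol'0 s b)
      _ = _ := by rw [sum_add_distrib, ← sum_mul, hpol'1, one_mul]
  have hsum : ∑ s', p s₀ a₀ s' * (∑ b, pol s' b * (Q s' b - η * Real.log (pol s' b))) ≤
      (∑ s', p s₀ a₀ s' * (∑ b, pol' s' b * (Q' s' b - η * Real.log (pol' s' b)))) + d :=
    calc _ ≤ ∑ s', p s₀ a₀ s' *
            ((∑ b, pol' s' b * (Q' s' b - η * Real.log (pol' s' b))) + d) :=
          sum_le_sum fun s' _ => mul_le_mul_of_nonneg_left (hV s') (hp0 s₀ a₀ s')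
      _ = _ := by simp_rw [mul_add, sum_add_distrib, ← sum_mul, hp1, one_mul]
  have hdγ : d ≤ γ * d := by
    have h := mul_le_mul_of_nonneg_left hsum hγ0
    linarith [hQfix s₀ a₀, hQ'fix s₀ a₀]
  have hd0 : d ≤ 0 := by
    by_contra! h
    nlinarith
  intro s a
  linarith [hle s a]
end
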